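/- For all positive integers d, l, r, r', s there are positive integers f = f(d,l,r,r',s) and g = g(d,l,r,r',s) with the following property. Let G be a graph and let M = (A_1,…,A_f; B_1,…,B_g) be a linear induced (f,g)-model in G. Then one of the following holds: (a) there is an (r,r)-constellation in G; (b) G has an induced minor isomorphic to a 1-subdivision of K_{r'}; or (c) there exist subsets X ⊆ {1,…,f} and Y ⊆ {1,…,g} with |X| = s and |Y| = l such that the linear induced (s,l)-model (A_i : i ∈ X; B_j : j ∈ Y) in G is d-ample. -/

import Mathlib

open SimpleGraph

/-- Two vertex sets `X` and `Y` are *anticomplete* in `G` if they are disjoint and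
there is no edge of `G` with an end in each. -/
def Anticomplete {V : Type} (G : SimpleGraph V) (X Y : Set V) : Prop :=
  Disjoint X Y ∧ ∀ x ∈ X, ∀ y ∈ Y, ¬ G.Adj x y

/-- `G` has an induced subgraph isomorphic to `H`. -/
def HasInducedSubgraphIso {V W : Type} (G : SimpleGraph V) (H : SimpleGraph W) : Prop :=
  ∃ X : Set V, Nonempty (H ≃g G.induce X)

/-- `G` has an induced minor isomorphic to `H`, witnessed by branch sets. -/
def HasInducedMinor {V W : Type} (G : SimpleGraph V) (H : SimpleGraph W) : Prop :=
  ∃ B : W → Set V,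
    (∀ w, (G.induce (B w)).Connected) ∧
    (Pairwise fun u v => Disjoint (B u) (B v)) ∧
    (∀ u v : W, u ≠ v → (H.Adj u v ↔ ¬ Anticomplete G (B u) (B v)))

/-- The set `P` induces a path in `G`. -/
def IsPathSet {V : Type} (G : SimpleGraph V) (P : Set V) : Prop :=
  ∃ n : ℕ, Nonempty (G.induce P ≃g pathGraph (n + 1))

/-- The vertex sets of the connected components of the subgraph of `G` induced on `X`. -/
def CompsOn {V : Type} (G : SimpleGraph V) (X : Set V) : Set (Set V) :=
  {L | ∃ C : (G.induce X).ConnectedComponent, L = Subtype.val '' C.supp}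

/-- The induced subgraph of `G` on `W` together with the stable set `S ⊆ W` forms a
constellation: every component of `W \ S` is a path and every vertex of `S` has a
neighbor in every such component. -/
structure IsConstellationOn {V : Type} (G : SimpleGraph V) (W S : Set V) : Prop where
  subset : S ⊆ W
  stable : ∀ x ∈ S, ∀ y ∈ S, ¬ G.Adj x y
  comp_paths : ∀ L ∈ CompsOn G (W \ S), IsPathSet G L
  dominates : ∀ x ∈ S, ∀ L ∈ CompsOn G (W \ S), ∃ y ∈ L, G.Adj x y

/-- `p` is a route of the constellation `(W, S)` in `G`: an induced path of the induced
subgraph of `G` on `W`, with its two (distinct) ends in `S` and its interior outside `S`. -/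
structure IsRoute {V : Type} (G : SimpleGraph V) (W S : Set V) {x y : V}
    (p : G.Walk x y) : Prop where
  ne : x ≠ y
  isPath : p.IsPath
  induced : ∀ u v, u ∈ p.support → v ∈ p.support → G.Adj u v → p.toSubgraph.Adj u v
  support_mem : ∀ v ∈ p.support, v ∈ W
  fst_mem : x ∈ S
  snd_mem : y ∈ S
  interior : ∀ v ∈ p.support, v ≠ x → v ≠ y → v ∉ S

/-- The constellation `(W, S)` in `G` is `d`-ample: no route has length at most `d+1`. -/
def DAmple {V : Type} (G : SimpleGraph V) (W S : Set V) (d : ℕ) : Prop :=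
  ∀ ⦃x y : V⦄ (p : G.Walk x y), IsRoute G W S p → d + 1 < p.length

/-- The constellation `(W, S)` in `G` is interrupted with respect to some linear order
(encoded by an injective-on-`S` function `f : V → ℕ`). -/
def Interrupted {V : Type} (G : SimpleGraph V) (W S : Set V) : Prop :=
  ∃ f : V → ℕ, Set.InjOn f S ∧
    ∀ x ∈ S, ∀ y ∈ S, ∀ z ∈ S, f x < f y → f y < f z →
      ∀ (p : G.Walk x y), IsRoute G W S p → ∃ v ∈ p.support, G.Adj z v

/-- The constellation `(W, S)` in `G` is `q`-zigzagged. -/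
def Zigzagged {V : Type} (G : SimpleGraph V) (W S : Set V) (q : ℕ) : Prop :=
  ∃ f : V → ℕ, Set.InjOn f S ∧
    ∀ x ∈ S, ∀ y ∈ S, f x < f y →
      ∀ (p : G.Walk x y), IsRoute G W S p →
        {z | z ∈ S ∧ f x < f z ∧ f z < f y ∧ ¬ ∃ v ∈ p.support, G.Adj z v}.ncard < q

/-- The constellation `(W, S)` in `G` is `(qm, q, qp)`-mixed. -/
def Mixed {V : Type} (G : SimpleGraph V) (W S : Set V) (qm q qp : ℕ) : Prop :=
  ∃ f : V → ℕ, Set.InjOn f S ∧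
    ∀ x ∈ S, ∀ y ∈ S, f x < f y →
      ∀ (p : G.Walk x y), IsRoute G W S p →
        ∀ Qm Q Qp : Set V, Qm ⊆ S → Q ⊆ S → Qp ⊆ S →
          Qm.ncard = qm → Q.ncard = q → Qp.ncard = qp →
          (∀ z ∈ Qm, f z < f x) → (∀ z ∈ Q, f x < f z ∧ f z < f y) →
          (∀ z ∈ Qp, f y < f z) →
          ∃ z ∈ Qm ∪ Q ∪ Qp, ∃ v ∈ p.support, G.Adj z v

/-- The constellation `(W', S')` sits in the constellation `(W, S)` (both within `G`). -/
def SitsIn {V : Type} (G : SimpleGraph V) (W' S' W S : Set V) : Prop :=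
  W' ⊆ W ∧ S' ⊆ S ∧
  (∀ L ∈ CompsOn G (W' \ S'), ∃ M ∈ CompsOn G (W \ S), L ⊆ M) ∧
  (∀ M ∈ CompsOn G (W \ S), ∀ L₁ ∈ CompsOn G (W' \ S'), ∀ L₂ ∈ CompsOn G (W' \ S'),
      L₁ ⊆ M → L₂ ⊆ M → L₁ = L₂)

/-- A witness that `S` is a subdivision of `H`, where each edge of `H` is replaced by a
path whose length satisfies `ok`. -/
structure SubdivModel {U W : Type} (S : SimpleGraph U) (H : SimpleGraph W)
    (ok : ℕ → Prop) where
  b : W → U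
  b_inj : Function.Injective b
  path : ∀ ⦃u v : W⦄, H.Adj u v → S.Walk (b u) (b v)
  path_isPath : ∀ ⦃u v : W⦄ (h : H.Adj u v), (path h).IsPath
  path_len : ∀ ⦃u v : W⦄ (h : H.Adj u v), ok (path h).length
  path_symm : ∀ ⦃u v : W⦄ (h : H.Adj u v), path h.symm = (path h).reverse
  branch_avoid : ∀ ⦃u v : W⦄ (h : H.Adj u v) (w : W), b w ∈ (path h).support → w = u ∨ w = v
  interiors_anticomplete :
    ∀ ⦃u v u' v' : W⦄ (h : H.Adj u v) (h' : H.Adj u' v'),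
      (s(u, v) : Sym2 W) ≠ s(u', v') →
      ∀ x ∈ (path h).support, x ≠ b u → x ≠ b v →
      ∀ y ∈ (path h').support, y ≠ b u' → y ≠ b v' →
        x ≠ y ∧ ¬ S.Adj x y
  cover : ∀ x : U, (∃ w, x = b w) ∨ ∃ (u v : W) (h : H.Adj u v), x ∈ (path h).support
  edges_eq : ∀ x y : U, S.Adj x y → ∃ (u v : W) (h : H.Adj u v), (path h).toSubgraph.Adj x y

/-- `S` is a subdivision of `H` with path lengths satisfying `ok`. -/
def IsSubdivisionWith {U W : Type} (S : SimpleGraph U) (H : SimpleGraph W)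
    (ok : ℕ → Prop) : Prop :=
  Nonempty (SubdivModel S H ok)

/-- The line graph of `G`. -/
def LineGraph {V : Type} (G : SimpleGraph V) : SimpleGraph G.edgeSet :=
  SimpleGraph.fromRel (fun e f => ∃ v : V, v ∈ (e : Sym2 V) ∧ v ∈ (f : Sym2 V))

/-- The `r`-by-`r` hexagonal wall (brick wall). -/
def Wall (r : ℕ) : SimpleGraph (Fin r × Fin (2 * r)) :=
  SimpleGraph.fromRel (fun a b =>
    (a.1 = b.1 ∧ a.2.val + 1 = b.2.val) ∨
    (a.2 = b.2 ∧ a.1.val + 1 = b.1.val ∧ (a.1.val + a.2.val) % 2 = 0))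

/-- The full binary tree of radius `r`, on `2^(r+1) - 1` vertices (heap indexing). -/
def BinTree (r : ℕ) : SimpleGraph (Fin (2 ^ (r + 1) - 1)) :=
  SimpleGraph.fromRel (fun a b =>
    b.val + 1 = 2 * (a.val + 1) ∨ b.val + 1 = 2 * (a.val + 1) + 1)

/-- The leaf-extension of `H` by leaves `L` attached via `f`. -/
def leafExt {W : Type} (H : SimpleGraph W) (L : Type) (f : L → W) :
    SimpleGraph (W ⊕ L) :=
  SimpleGraph.fromRel (fun a b =>
    match a, b with
    | Sum.inl a, Sum.inl b => H.Adj a b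
    | Sum.inl a, Sum.inr x => f x = a
    | _, _ => False)

/-- `G` has treewidth at most `k` (via tree decompositions). -/
def TreewidthLE {V : Type} (G : SimpleGraph V) (k : ℕ) : Prop :=
  ∃ (ι : Type) (T : SimpleGraph ι) (bag : ι → Set V),
    T.IsTree ∧
    (∀ v, ∃ i, v ∈ bag i) ∧
    (∀ u v, G.Adj u v → ∃ i, u ∈ bag i ∧ v ∈ bag i) ∧
    (∀ v, (T.induce {i | v ∈ bag i}).Connected) ∧
    (∀ i, (bag i).ncard ≤ k + 1)

/-- `G` has pathwidth at most `k` (via path decompositions). -/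
def PathwidthLE {V : Type} (G : SimpleGraph V) (k : ℕ) : Prop :=
  ∃ (n : ℕ) (bag : Fin n → Set V),
    (∀ v, ∃ i, v ∈ bag i) ∧
    (∀ u v, G.Adj u v → ∃ i, u ∈ bag i ∧ v ∈ bag i) ∧
    (∀ (v : V) (i j k' : Fin n), i ≤ j → j ≤ k' → v ∈ bag i → v ∈ bag k' → v ∈ bag j) ∧
    (∀ i, (bag i).ncard ≤ k + 1)

/-- An induced `(s,t)`-model in `G`. -/
def IsInducedModel {V : Type} (G : SimpleGraph V) {s t : ℕ}
    (A : Fin s → Set V) (B : Fin t → Set V) : Prop :=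
  (∀ i, (G.induce (A i)).Connected) ∧
  (∀ j, (G.induce (B j)).Connected) ∧
  (∀ i j : Fin s, i ≠ j → Anticomplete G (A i) (A j)) ∧
  (∀ i j : Fin t, i ≠ j → Anticomplete G (B i) (B j)) ∧
  (∀ (i : Fin s) (j : Fin t), Disjoint (A i) (B j) ∧ ¬ Anticomplete G (A i) (B j))

/-- The `A`-contraction of a model: each `A i` is contracted to the vertex `Sum.inl i`. -/
def AContraction {V : Type} (G : SimpleGraph V) {s t : ℕ}
    (A : Fin s → Set V) (B : Fin t → Set V) :
    SimpleGraph (Fin s ⊕ (⋃ j, B j : Set V)) :=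
  SimpleGraph.fromRel (fun x y =>
    match x, y with
    | Sum.inl i, Sum.inl i' => i ≠ i' ∧ ∃ a ∈ A i, ∃ a' ∈ A i', G.Adj a a'
    | Sum.inl i, Sum.inr b => ∃ a ∈ A i, G.Adj a ↑b
    | Sum.inr b, Sum.inr b' => G.Adj ↑b ↑b'
    | _, _ => False)

/-- A linear induced model is `d`-`A`-ample if its `A`-contraction is `d`-ample. -/
def ModelAAmple {V : Type} (G : SimpleGraph V) {s t : ℕ}
    (A : Fin s → Set V) (B : Fin t → Set V) (d : ℕ) : Prop :=
  DAmple (AContraction G A B) Set.univ (Set.range Sum.inl) d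

/-- A linear induced model is `d`-ample if it is `d`-`A`-ample and `d`-`B`-ample. -/
def ModelAmple {V : Type} (G : SimpleGraph V) {s t : ℕ}
    (A : Fin s → Set V) (B : Fin t → Set V) (d : ℕ) : Prop :=
  ModelAAmple G A B d ∧ ModelAAmple G B A d

/-- The zigzag sequences. -/
def Zseq : ℕ → List ℤ
  | 0 => []
  | 1 => [1]
  | 2 => [1, 2]
  | 3 => [1, 2, 3]
  | n + 4 =>
      (Zseq (n + 3)).dropLast ++ (((Zseq (n + 2)).map (· + 1)).reverse).dropLast
        ++ (Zseq (n + 3)).map (· + 1)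

/-- Collapse each maximal run of consecutive equal entries to a single entry. -/
def collapse (l : List ℤ) : List ℤ := l.destutter (· ≠ ·)

/-- `B` is an alignment in the sequence `A`. -/
def IsAlignment (A : List ℤ) (B : Finset ℤ) : Prop :=
  (∀ b ∈ B, b ∈ A) ∧
  ∃ i j : ℕ, i ≤ j ∧ j < A.length ∧
    ∀ b ∈ B,
      (collapse (((A.take (j + 1)).drop i).filter (fun a => decide (a ∈ B)))).count b = 1

/-- Ramsey's theorem for a symmetric relation, in the off-diagonal form. -/
lemma exists_subset_pairwise_or_pairwise_not {α : Type*} {R : α → α → Prop}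
    (hR : ∀ x y, R x y → R y x) (n : ℕ) :
    ∀ (a b : ℕ) (X : Finset α), a + b = n → 2 ^ n ≤ X.card →
      ∃ Y ⊆ X, (Y.card = a ∧ (Y : Set α).Pairwise fun x y => ¬ R x y) ∨
        (Y.card = b ∧ (Y : Set α).Pairwise R) := by
  classical
  induction n with
  | zero =>
    intro a b X hab _
    exact ⟨∅, by simp, Or.inl ⟨by simp; omega, by simp⟩⟩
  | succ n ih =>
    intro a b X hab hX
    rcases Nat.eq_zero_or_pos a with rfl | ha
    · exact ⟨∅, by simp, Or.inl ⟨by simp, by simp⟩⟩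
    rcases Nat.eq_zero_or_pos b with rfl | hb
    · exact ⟨∅, by simp, Or.inr ⟨by simp, by simp⟩⟩
    obtain ⟨v, hv⟩ : X.Nonempty := by
      rw [← Finset.card_pos]
      exact lt_of_lt_of_le (by positivity) hX
    have hsplit := Finset.card_filter_add_card_filter_not (s := X.erase v) (fun x => R v x)
    rw [Finset.card_erase_of_mem hv] at hsplit
    rw [pow_succ] at hX
    by_cases hN : 2 ^ n ≤ ((X.erase v).filter fun x => R v x).card
    · obtain ⟨Y, hY, h⟩ := ih a (b - 1) _ (by omega) hN
      have hYX : ∀ y ∈ Y, y ∈ X ∧ y ≠ v ∧ R v y := fun y hy => by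
        have := hY hy
        simp only [Finset.mem_filter, Finset.mem_erase] at this
        tauto
      rcases h with h | ⟨hc, hp⟩
      · exact ⟨Y, fun y hy => (hYX y hy).1, Or.inl h⟩
      · refine ⟨insert v Y, ?_, Or.inr ⟨?_, ?_⟩⟩
        · intro y hy
          rcases Finset.mem_insert.1 hy with rfl | hy
          exacts [hv, (hYX y hy).1]
        · rw [Finset.card_insert_of_notMem fun h => (hYX v h).2.1 rfl]
          omega
        · rw [Finset.coe_insert]
          exact hp.insert fun y hy _ => ⟨(hYX y hy).2.2, hR _ _ (hYX y hy).2.2⟩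
    · obtain ⟨Y, hY, h⟩ := ih (a - 1) b ((X.erase v).filter fun x => ¬ R v x) (by omega)
        (by omega)
      have hYX : ∀ y ∈ Y, y ∈ X ∧ y ≠ v ∧ ¬ R v y := fun y hy => by
        have := hY hy
        simp only [Finset.mem_filter, Finset.mem_erase] at this
        tauto
      rcases h with ⟨hc, hp⟩ | h
      · refine ⟨insert v Y, ?_, Or.inl ⟨?_, ?_⟩⟩
        · intro y hy
          rcases Finset.mem_insert.1 hy with rfl | hy
          exacts [hv, (hYX y hy).1]
        · rw [Finset.card_insert_of_notMem fun h => (hYX v h).2.1 rfl]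
          omega
        · rw [Finset.coe_insert]
          exact hp.insert fun y hy _ =>
            ⟨(hYX y hy).2.2, fun h => (hYX y hy).2.2 (hR _ _ h)⟩
      · exact ⟨Y, fun y hy => (hYX y hy).1, Or.inr h⟩

/-- Given a set mapping `T` on pairs with values of size at most `K`, one can choose one
element from each of `n` large classes so that the chosen set is free for `T`. -/
lemma exists_free_transversal {α : Type*} {n N K : ℕ} (T : Sym2 α → Finset α)
    (hT : ∀ e, (T e).card ≤ K) (c : Fin n × Fin N → α) (hc : Function.Injective c)
    (hN : n ^ 3 * K < N) :
    ∃ φ : Fin n → Fin N, ∀ a b k, k ≠ a → k ≠ b →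
      c (k, φ k) ∉ T s(c (a, φ a), c (b, φ b)) := by
  classical
  by_contra! hcon
  let bad : Fin n × Fin n × Fin n → Finset (Fin n → Fin N) := fun t =>
    Finset.univ.filter fun φ => t.2.2 ≠ t.1 ∧ t.2.2 ≠ t.2.1 ∧
      c (t.2.2, φ t.2.2) ∈ T s(c (t.1, φ t.1), c (t.2.1, φ t.2.1))
  have hcover : (Finset.univ : Finset (Fin n → Fin N)) ⊆ Finset.univ.biUnion bad := by
    intro φ _
    obtain ⟨a, b, k, h⟩ := hcon φ
    exact Finset.mem_biUnion.2 ⟨(a, b, k), Finset.mem_univ _, by simpa [bad] using h⟩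
  have hbad : ∀ t, (bad t).card ≤ K * N ^ (n - 1) := by
    rintro ⟨a, b, k⟩
    have hmain := Finset.card_le_mul_card_image_of_maps_to (s := bad (a, b, k))
      (t := (Finset.univ : Finset ({x : Fin n // x ≠ k} → Fin N)))
      (f := fun φ x => φ x.1) (fun _ _ => Finset.mem_univ _) K ?_
    · simpa using hmain
    intro ψ _
    rcases (Finset.filter (fun φ : Fin n → Fin N => (fun x : {x : Fin n // x ≠ k} => φ x) = ψ)
      (bad (a, b, k))).eq_empty_or_nonempty with he | ⟨φ₀, h₀⟩
    · rw [he]; simp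
    refine le_trans ?_ (hT s(c (a, φ₀ a), c (b, φ₀ b)))
    have hmem : ∀ φ ∈ Finset.filter
        (fun φ : Fin n → Fin N => (fun x : {x : Fin n // x ≠ k} => φ x) = ψ) (bad (a, b, k)),
        (k ≠ a ∧ k ≠ b ∧ c (k, φ k) ∈ T s(c (a, φ a), c (b, φ b))) ∧
          ∀ x, x ≠ k → φ x = φ₀ x := by
      intro φ hφ
      simp only [bad, Finset.mem_filter, Finset.mem_univ, true_and] at hφ h₀
      exact ⟨hφ.1, fun x hx => congrFun (hφ.2.trans h₀.2.symm) ⟨x, hx⟩⟩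
    refine Finset.card_le_card_of_injOn (fun φ => c (k, φ k)) ?_ ?_
    · intro φ hφ
      obtain ⟨⟨hka, hkb, h⟩, hx⟩ := hmem φ hφ
      rwa [hx a hka.symm, hx b hkb.symm] at h
    · intro φ hφ φ' hφ' h
      have hk : φ k = φ' k := by simpa using hc h
      funext x
      by_cases hx : x = k
      · rw [hx, hk]
      · rw [(hmem φ hφ).2 x hx, (hmem φ' hφ').2 x hx]
  have h1 := (Finset.card_le_card hcover).trans
    (Finset.card_biUnion_le_card_mul _ _ _ fun t _ => hbad t)
  simp only [Finset.card_univ, Fintype.card_fun, Fintype.card_fin, Fintype.card_prod] at h1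
  rcases Nat.eq_zero_or_pos n with rfl | hn
  · simp at h1
  · obtain ⟨m, rfl⟩ : ∃ m, n = m + 1 := ⟨n - 1, by omega⟩
    have hpos : 0 < N ^ m := pow_pos (by omega) _
    rw [Nat.add_sub_cancel, pow_succ] at h1
    have h2 : N ^ m * ((m + 1) ^ 3 * K) < N ^ m * N := Nat.mul_lt_mul_of_pos_left hN hpos
    have h3 : (m + 1) * ((m + 1) * (m + 1)) * (K * N ^ m) = N ^ m * ((m + 1) ^ 3 * K) := by ring
    omega

/-- The `1`-subdivision of the complete graph on `n` vertices. -/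
def completeSubdivision (n : ℕ) : SimpleGraph (Fin n ⊕ {e : Sym2 (Fin n) // ¬ e.IsDiag}) where
  Adj x y := match x, y with
    | Sum.inl i, Sum.inr e => i ∈ e.1
    | Sum.inr e, Sum.inl i => i ∈ e.1
    | _, _ => False
  symm := ⟨by rintro (i | e) (j | f) h <;> exact h⟩
  loopless := ⟨by rintro (i | e) h <;> exact h⟩

lemma isSubdivisionWith_of_iso {n : ℕ} {U : Type} {S : SimpleGraph U}
    (φ : S ≃g completeSubdivision n) :
    IsSubdivisionWith S (⊤ : SimpleGraph (Fin n)) (fun k => k = 2) := by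
  have hmid : ∀ {u v : Fin n}, (⊤ : SimpleGraph (Fin n)).Adj u v → ¬ (s(u, v)).IsDiag :=
    fun h => by simpa using h
  let mid : ∀ {u v : Fin n}, (⊤ : SimpleGraph (Fin n)).Adj u v → U :=
    fun {u v} h => φ.symm (Sum.inr ⟨s(u, v), hmid h⟩)
  have h1 : ∀ {u v : Fin n} (h : (⊤ : SimpleGraph (Fin n)).Adj u v),
      S.Adj (φ.symm (Sum.inl u)) (mid h) := fun h => by
    rw [φ.symm.map_adj_iff]
    exact Sym2.mem_mk_left _ _
  have h2 : ∀ {u v : Fin n} (h : (⊤ : SimpleGraph (Fin n)).Adj u v),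
      S.Adj (mid h) (φ.symm (Sum.inl v)) := fun h => by
    rw [φ.symm.map_adj_iff]
    exact Sym2.mem_mk_right _ _
  refine ⟨{
    b := fun i => φ.symm (Sum.inl i)
    b_inj := fun i j h => by simpa using h
    path := fun u v h => Walk.cons (h1 h) (Walk.cons (h2 h) Walk.nil)
    path_isPath := ?_
    path_len := ?_
    path_symm := ?_
    branch_avoid := ?_
    interiors_anticomplete := ?_
    cover := ?_
    edges_eq := ?_ }⟩
  · intro u v h
    have : u ≠ v := h
    simp [mid, this]
  · intro u v h
    rfl
  · intro u v h
    apply Walk.ext_support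
    simp [mid, Sym2.eq_swap]
  · intro u v h w hw
    simpa [mid] using hw
  · intro u v u' v' h h' hne x hx hxu hxv y hy hyu hyv
    simp only [Walk.support_cons, Walk.support_nil, List.mem_cons, List.not_mem_nil,
      or_false] at hx hy
    obtain rfl : x = mid h := by tauto
    obtain rfl : y = mid h' := by tauto
    refine ⟨fun h => hne (by simpa [mid] using h), fun h => ?_⟩
    rw [φ.symm.map_adj_iff] at h
    exact h
  · intro x
    obtain ⟨x, rfl⟩ := φ.symm.surjective x
    rcases x with i | ⟨e, he⟩
    · exact Or.inl ⟨i, rfl⟩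
    · induction e with | _ u v
      exact Or.inr ⟨u, v, by simpa using he, by simp [mid]⟩
  · intro x y hxy
    obtain ⟨x, rfl⟩ := φ.symm.surjective x
    obtain ⟨y, rfl⟩ := φ.symm.surjective y
    rw [φ.symm.map_adj_iff] at hxy
    rcases x with i | ⟨e, he⟩ <;> rcases y with j | ⟨f, hf⟩
    · exact hxy.elim
    · obtain ⟨v, rfl⟩ : ∃ v, f = s(i, v) := hxy
      exact ⟨i, v, by simpa using hf, by simp [mid]⟩
    · obtain ⟨v, rfl⟩ : ∃ v, e = s(j, v) := hxy
      exact ⟨j, v, by simpa using he, by simp [mid]⟩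
    · exact hxy.elim

lemma HasInducedMinor.of_iso {V U W : Type} {G : SimpleGraph V} {H : SimpleGraph U}
    {K : SimpleGraph W} (φ : H ≃g K) (h : HasInducedMinor G K) : HasInducedMinor G H := by
  obtain ⟨B, hconn, hdisj, hadj⟩ := h
  exact ⟨fun u => B (φ u), fun u => hconn _, fun u v huv => hdisj (φ.injective.ne huv),
    fun u v huv => by rw [← hadj _ _ (φ.injective.ne huv), φ.map_adj_iff]⟩

lemma exists_subdivision_inducedMinor {V : Type} {G : SimpleGraph V} {n : ℕ}
    (h : HasInducedMinor G (completeSubdivision n)) :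
    ∃ (m : ℕ) (H : SimpleGraph (Fin m)),
      IsSubdivisionWith H (⊤ : SimpleGraph (Fin n)) (fun k => k = 2) ∧
      HasInducedMinor G H := by
  classical
  let φ := (completeSubdivision n).overFinIso rfl
  exact ⟨_, _, isSubdivisionWith_of_iso φ.symm, h.of_iso φ.symm⟩

lemma Anticomplete.symm {V : Type} {G : SimpleGraph V} {X Y : Set V}
    (h : Anticomplete G X Y) : Anticomplete G Y X :=
  ⟨h.1.symm, fun x hx y hy hxy => h.2 y hy x hx hxy.symm⟩

lemma Anticomplete.mono {V : Type} {G : SimpleGraph V} {X Y X' Y' : Set V}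
    (h : Anticomplete G X Y) (hX : X' ⊆ X) (hY : Y' ⊆ Y) : Anticomplete G X' Y' :=
  ⟨h.1.mono hX hY, fun x hx y hy => h.2 x (hX hx) y (hY hy)⟩

/-- A model of a `1`-subdivision of a complete graph, from branch sets `C` for the vertices
and `D` for the edges. -/
lemma hasInducedMinor_completeSubdivision {V : Type} {G : SimpleGraph V} {n : ℕ}
    (C : Fin n → Set V) (D : {e : Sym2 (Fin n) // ¬ e.IsDiag} → Set V)
    (hC : ∀ i, (G.induce (C i)).Connected) (hD : ∀ e, (G.induce (D e)).Connected)
    (hCC : ∀ i j, i ≠ j → Anticomplete G (C i) (C j))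
    (hDD : ∀ e f, e ≠ f → Anticomplete G (D e) (D f))
    (hdisj : ∀ i e, Disjoint (C i) (D e))
    (hCD : ∀ i e, i ∈ e.1 ↔ ∃ x ∈ C i, ∃ y ∈ D e, G.Adj x y) :
    HasInducedMinor G (completeSubdivision n) := by
  have key : ∀ i e, i ∈ e.1 ↔ ¬ Anticomplete G (C i) (D e) := by
    intro i e
    rw [hCD, Anticomplete]
    have := hdisj i e
    push Not
    tauto
  refine ⟨Sum.elim C D, ?_, ?_, ?_⟩
  · rintro (i | e)
    exacts [hC i, hD e]
  · rintro (i | e) (j | f) h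
    · exact (hCC i j fun h' => h (by rw [h'])).1
    · exact hdisj i f
    · exact (hdisj j e).symm
    · exact (hDD e f fun h' => h (by rw [h'])).1
  · rintro (i | e) (j | f) h
    · exact iff_of_false id fun h' => h' (hCC i j fun h' => h (by rw [h']))
    · exact key i f
    · exact (key j e).trans (not_congr ⟨Anticomplete.symm, Anticomplete.symm⟩)
    · exact iff_of_false id fun h' => h' (hDD e f fun h' => h (by rw [h']))

lemma compsOn_iUnion {V ι : Type} {G : SimpleGraph V} {A : ι → Set V}
    (hA : ∀ i, (G.induce (A i)).Connected)
    (hAA : ∀ i j, i ≠ j → Anticomplete G (A i) (A j)) :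
    CompsOn G (⋃ i, A i) = Set.range A := by
  have key : ∀ i (v : V) (hv : v ∈ A i),
      Subtype.val '' ((G.induce (⋃ i, A i)).connectedComponentMk
        ⟨v, Set.mem_iUnion_of_mem i hv⟩).supp = A i := by
    intro i v hv
    have hwalk : ∀ x y : (⋃ i, A i : Set V), (G.induce (⋃ i, A i)).Walk x y →
        x.1 ∈ A i → y.1 ∈ A i := by
      intro x y p
      induction p with
      | nil => exact id
      | @cons x y z h q ih =>
        intro hx
        refine ih ?_
        obtain ⟨j, hj⟩ := Set.mem_iUnion.1 y.2
        by_cases hij : i = j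
        · rwa [hij]
        · exact ((hAA i j hij).2 _ hx _ hj h).elim
    ext w
    constructor
    · rintro ⟨w, hw, rfl⟩
      obtain ⟨p⟩ := (ConnectedComponent.eq.1 hw).symm
      exact hwalk _ _ p hv
    · intro hw
      refine ⟨⟨w, Set.mem_iUnion_of_mem i hw⟩, ?_, rfl⟩
      have := ((hA i).preconnected ⟨w, hw⟩ ⟨v, hv⟩).map
        (G.induceHomOfLE (Set.subset_iUnion A i)).toHom
      exact ConnectedComponent.eq.2 this
  ext L
  constructor
  · rintro ⟨C, rfl⟩
    induction C using ConnectedComponent.ind with | _ v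
    obtain ⟨i, hi⟩ := Set.mem_iUnion.1 v.2
    exact ⟨i, (key i v.1 hi).symm⟩
  · rintro ⟨i, rfl⟩
    obtain ⟨v, hv⟩ := (hA i).nonempty
    exact ⟨_, (key i v hv).symm⟩

lemma exists_constellation {V : Type} {G : SimpleGraph V} {r : ℕ}
    (A : Fin r → Set V) (v : Fin r → V)
    (hA : ∀ i, (G.induce (A i)).Connected) (hpath : ∀ i, IsPathSet G (A i))
    (hAA : ∀ i j, i ≠ j → Anticomplete G (A i) (A j))
    (hv : Function.Injective v) (hvv : ∀ i j, ¬ G.Adj (v i) (v j))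
    (hAv : ∀ i j, v j ∉ A i) (hadj : ∀ i j, ∃ a ∈ A i, G.Adj a (v j)) :
    ∃ W S : Set V, IsConstellationOn G W S ∧ S.ncard = r ∧ (CompsOn G (W \ S)).ncard = r := by
  have hdiff : ((⋃ i, A i) ∪ Set.range v) \ Set.range v = ⋃ i, A i := by
    rw [Set.union_sdiff_right, sdiff_eq_left, Set.disjoint_left]
    rintro _ hx ⟨j, rfl⟩
    obtain ⟨i, hi⟩ := Set.mem_iUnion.1 hx
    exact hAv i j hi
  have hinj : Function.Injective A := by
    intro i j hij
    by_contra hne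
    obtain ⟨x, hx⟩ := (hA i).nonempty
    exact Set.disjoint_left.1 (hAA i j hne).1 hx (hij ▸ hx)
  refine ⟨(⋃ i, A i) ∪ Set.range v, Set.range v, ⟨Set.subset_union_right, ?_, ?_, ?_⟩, ?_, ?_⟩
  · rintro _ ⟨i, rfl⟩ _ ⟨j, rfl⟩
    exact hvv i j
  · rw [hdiff, compsOn_iUnion hA hAA]
    rintro _ ⟨i, rfl⟩
    exact hpath i
  · rw [hdiff, compsOn_iUnion hA hAA]
    rintro _ ⟨j, rfl⟩ _ ⟨i, rfl⟩
    obtain ⟨a, ha, h⟩ := hadj i j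
    exact ⟨a, ha, h.symm⟩
  · rw [← Set.image_univ, Set.ncard_image_of_injective _ hv, Set.ncard_univ, Nat.card_fin]
  · rw [hdiff, compsOn_iUnion hA hAA, ← Set.image_univ, Set.ncard_image_of_injective _ hinj,
      Set.ncard_univ, Nat.card_fin]

/-- `X` and `X'` both have neighbors in a common connected subset of `B` of size at most `d`. -/
def ShortLink {V : Type} (G : SimpleGraph V) (d : ℕ) (X X' B : Set V) : Prop :=
  ∃ D : Finset V, (D : Set V) ⊆ B ∧ (G.induce (D : Set V)).Connected ∧ D.card ≤ d ∧
    (∃ a ∈ X, ∃ y ∈ D, G.Adj a y) ∧ (∃ a ∈ X', ∃ y ∈ D, G.Adj a y)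

lemma ShortLink.symm {V : Type} {G : SimpleGraph V} {d : ℕ} {X X' B : Set V}
    (h : ShortLink G d X X' B) : ShortLink G d X' X B := by
  obtain ⟨D, h1, h2, h3, h4, h5⟩ := h
  exact ⟨D, h1, h2, h3, h5, h4⟩

lemma exists_connected_of_walk {V : Type} {G : SimpleGraph V} {s t : ℕ}
    {A : Fin s → Set V} {B : Fin t → Set V}
    (hBB : ∀ i j, i ≠ j → Anticomplete G (B i) (B j))
    {u v : Fin s ⊕ (⋃ j, B j : Set V)} (q : (AContraction G A B).Walk u v) :
    ∀ (b : (⋃ j, B j : Set V)) (i : Fin s) (j : Fin t), u = Sum.inr b → v = Sum.inl i →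
      b.1 ∈ B j → (∀ w ∈ q.support, w ≠ v → w ∉ Set.range Sum.inl) →
      ∃ D : Finset V, (D : Set V) ⊆ B j ∧ (G.induce (D : Set V)).Connected ∧
        D.card ≤ q.length ∧ b.1 ∈ D ∧ ∃ a ∈ A i, ∃ y ∈ D, G.Adj a y := by
  classical
  induction q with
  | nil =>
    rintro b i j rfl h
    cases h
  | @cons u z v h q ih =>
    rintro b i j rfl rfl hb hq
    rcases z with k | b'
    · have hk : k = i := by
        by_contra hne
        exact hq (Sum.inl k) (by simp) (by simpa using hne) ⟨k, rfl⟩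
      subst hk
      refine ⟨{b.1}, by simpa using hb, ?_, by simp, by simp, ?_⟩
      · rw [Finset.coe_singleton]
        exact Connected.of_subsingleton
      · obtain ⟨a, ha, hab⟩ : ∃ a ∈ A k, G.Adj a b.1 := by
          simpa [AContraction] using h
        exact ⟨a, ha, b.1, by simp, hab⟩
    · have hbb : G.Adj b.1 b'.1 := by
        have h' : b ≠ b' ∧ (G.Adj b.1 b'.1 ∨ G.Adj b'.1 b.1) := by
          simpa [AContraction] using h
        exact h'.2.elim id Adj.symm
      have hb' : b'.1 ∈ B j := by
        obtain ⟨j', hj'⟩ := Set.mem_iUnion.1 b'.2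
        by_cases hj : j = j'
        · rwa [hj]
        · exact ((hBB j j' hj).2 _ hb _ hj' hbb).elim
      obtain ⟨D, hDB, hD, hcard, hbD, a, ha, y, hy, hay⟩ := ih b' i j rfl rfl hb'
        fun w hw => hq w (by simp [hw])
      refine ⟨insert b.1 D, ?_, ?_, ?_, Finset.mem_insert_self _ _, a, ha, y,
        Finset.mem_insert_of_mem hy, hay⟩
      · rw [Finset.coe_insert]
        exact Set.insert_subset hb hDB
      · rw [Finset.coe_insert, ← Set.singleton_union]
        exact connected_induce_union Preconnected.of_subsingleton hD.preconnected
          (Set.mem_singleton _) hbD hbb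
      · rw [Walk.length_cons]
        exact (Finset.card_insert_le _ _).trans (by omega)

lemma modelAAmple_of_not_shortLink {V : Type} {G : SimpleGraph V} {d s t : ℕ}
    {A : Fin s → Set V} {B : Fin t → Set V}
    (hAA : ∀ i j, i ≠ j → Anticomplete G (A i) (A j))
    (hBB : ∀ i j, i ≠ j → Anticomplete G (B i) (B j))
    (h : ∀ i i' j, i ≠ i' → ¬ ShortLink G d (A i) (A i') (B j)) :
    ModelAAmple G A B d := by
  intro x y p hp
  by_contra hlen
  obtain ⟨i, rfl⟩ := hp.fst_mem
  obtain ⟨i', rfl⟩ := hp.snd_mem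
  have hii : i ≠ i' := fun h => hp.ne (by rw [h])
  cases p with
  | nil => exact hii rfl
  | @cons _ z _ hadj q =>
    rcases z with k | b
    · obtain ⟨hik, hik'⟩ : i ≠ k ∧ ((∃ a ∈ A i, ∃ a' ∈ A k, G.Adj a a') ∨
          ∃ a ∈ A k, ∃ a' ∈ A i, G.Adj a a') := by
        have := hadj
        simp only [AContraction, fromRel_adj] at this
        refine ⟨fun h => this.1 (by rw [h]), this.2.imp (·.2) (·.2)⟩
      rcases hik' with ⟨a, ha, a', ha', haa⟩ | ⟨a, ha, a', ha', haa⟩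
      · exact (hAA i k hik).2 a ha a' ha' haa
      · exact (hAA k i hik.symm).2 a ha a' ha' haa
    · obtain ⟨a, ha, hab⟩ : ∃ a ∈ A i, G.Adj a b.1 := by
        simpa [AContraction] using hadj
      obtain ⟨j, hj⟩ := Set.mem_iUnion.1 b.2
      obtain ⟨D, hDB, hD, hcard, hbD, htouch⟩ :=
        exists_connected_of_walk hBB q b i' j rfl rfl hj fun w hw hne =>
          hp.interior w (by simp [hw])
            (fun hwi => ((Walk.cons_isPath_iff _ _).1 hp.isPath).2 (hwi ▸ hw)) hne
      rw [Walk.length_cons] at hlen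
      exact h i i' j hii ⟨D, hDB, hD, by omega, ⟨a, ha, b.1, hbD, hab⟩, htouch⟩

/-- The conclusion of the theorem with ampleness on one side only. -/
lemma exists_not_shortLink (d l r n s : ℕ) (hl : 0 < l) :
    ∃ f g : ℕ, 0 < f ∧ 0 < g ∧
      ∀ (V : Type) (G : SimpleGraph V) (A : Fin f → Set V) (B : Fin g → Set V),
        IsInducedModel G A B → (∀ i, IsPathSet G (A i)) →
          (∃ W S : Set V, IsConstellationOn G W S ∧ S.ncard = r ∧
              (CompsOn G (W \ S)).ncard = r) ∨
          HasInducedMinor G (completeSubdivision n) ∨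
          (∃ (x : Fin s ↪ Fin f) (y : Fin l ↪ Fin g),
              ∀ i i' j, i ≠ i' → ¬ ShortLink G d (A (x i)) (A (x i')) (B (y j))) := by
  classical
  set N := n ^ 3 * (d * r) + 1 with hN
  set f := 2 ^ (s + n * N) with hf
  set m := l + r + Fintype.card (Sym2 (Fin f)) with hm
  let τ := (Fin f → Fin f → Prop) × (Finset (Fin f) → Prop)
  refine ⟨f, Fintype.card τ * m + 1, by positivity, by omega, ?_⟩
  intro V G A B ⟨hA, hB, hAA, hBB, hAB⟩ hpath
  let type : Fin (Fintype.card τ * m + 1) → τ := fun j =>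
    (fun i i' => ShortLink G d (A i) (A i') (B j),
      fun T => ∃ v ∈ B j, ∀ i ∈ T, ∃ a ∈ A i, G.Adj a v)
  obtain ⟨t, ht⟩ := Fintype.exists_le_card_fiber_of_mul_le_card (n := m) type (by simp)
  obtain ⟨y₀⟩ : Nonempty (Fin m ↪ {j // j ∈ Finset.univ.filter fun j => type j = t}) :=
    Function.Embedding.nonempty_of_card_le (by rwa [Fintype.card_fin, Fintype.card_coe])
  let y : Fin m ↪ Fin (Fintype.card τ * m + 1) := y₀.trans (Function.Embedding.subtype _)
  have hy : ∀ k, type (y k) = t := fun k => (Finset.mem_filter.1 (y₀ k).2).2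
  have hlink : ∀ k i i', t.1 i i' ↔ ShortLink G d (A i) (A i') (B (y k)) := fun k i i' => by
    rw [← hy k]
  have htouch : ∀ k T, t.2 T ↔ ∃ v ∈ B (y k), ∀ i ∈ T, ∃ a ∈ A i, G.Adj a v := fun k T => by
    rw [← hy k]
  by_cases hT : ∃ T : Finset (Fin f), T.card = r ∧ t.2 T
  · left
    obtain ⟨T, hTr, hT⟩ := hT
    choose v hvB hvA using fun k => (htouch k T).1 hT
    let z : Fin r ↪ Fin m := Fin.castLEEmb (by omega)
    let x := T.orderEmbOfFin hTr
    have hx : ∀ i, x i ∈ T := T.orderEmbOfFin_mem hTr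
    refine exists_constellation (fun i => A (x i)) (fun k => v (z k)) (fun i => hA _)
      (fun i => hpath _) (fun i j hij => hAA _ _ (x.injective.ne hij)) ?_ ?_ ?_ ?_
    · intro i j hij
      by_contra hne
      exact Set.disjoint_left.1 (hBB _ _ (y.injective.ne (z.injective.ne hne))).1 (hvB _)
        (by have := hvB (z j); rwa [← show v (z i) = v (z j) from hij] at this)
    · intro i j h
      by_cases hij : i = j
      · exact G.ne_of_adj h (by rw [hij])
      · exact (hBB _ _ (y.injective.ne (z.injective.ne hij))).2 _ (hvB _) _ (hvB _) h
    · intro i j h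
      exact Set.disjoint_left.1 (hAB _ _).1 h (hvB (z j))
    · intro i j
      exact hvA _ _ (hx i)
  right
  have hsymm : ∀ i i', t.1 i i' → t.1 i' i := fun i i' h => by
    rw [hlink ⟨0, by omega⟩] at h ⊢
    exact h.symm
  obtain ⟨X, -, ⟨hXs, hX⟩ | ⟨hXn, hX⟩⟩ :=
    exists_subset_pairwise_or_pairwise_not hsymm (s + n * N) s (n * N) Finset.univ rfl
      (by rw [Finset.card_univ, Fintype.card_fin])
  · right
    refine ⟨(X.orderEmbOfFin hXs).toEmbedding, (Fin.castLEEmb (by omega)).trans y, ?_⟩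
    intro i i' j hii h
    exact hX (X.orderEmbOfFin_mem hXs i) (X.orderEmbOfFin_mem hXs i')
      ((X.orderEmbOfFin hXs).injective.ne hii) ((hlink _ _ _).2 h)
  left
  obtain ⟨p⟩ : Nonempty (Sym2 (Fin f) ↪ Fin m) :=
    Function.Embedding.nonempty_of_card_le (by rw [Fintype.card_fin]; omega)
  have hD : ∀ e : Sym2 (Fin f), ∃ D : Finset V, D.card ≤ d ∧ (D : Set V) ⊆ B (y (p e)) ∧
      (¬ e.IsDiag → (∀ i ∈ e, i ∈ X) → (G.induce (D : Set V)).Connected ∧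
        ∀ i ∈ e, ∃ a ∈ A i, ∃ b ∈ D, G.Adj a b) := by
    intro e
    by_cases he : ¬ e.IsDiag ∧ ∀ i ∈ e, i ∈ X
    · obtain ⟨hdiag, heX⟩ := he
      induction e with | _ i i'
      obtain ⟨D, hDB, hDc, hDd, hi, hi'⟩ := (hlink (p s(i, i')) i i').1
        (hX (heX i (Sym2.mem_mk_left _ _)) (heX i' (Sym2.mem_mk_right _ _))
          (by simpa using hdiag))
      refine ⟨D, hDd, hDB, fun _ _ => ⟨hDc, ?_⟩⟩
      intro k hk
      rcases Sym2.mem_iff.1 hk with rfl | rfl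
      exacts [hi, hi']
    · exact ⟨∅, by simp, by simp, fun h1 h2 => (he ⟨h1, h2⟩).elim⟩
  choose D hDd hDB hDe using hD
  let T : Sym2 (Fin f) → Finset (Fin f) := fun e =>
    Finset.univ.filter fun i => ∃ a ∈ A i, ∃ b ∈ D e, G.Adj a b
  have hTcard : ∀ e, (T e).card ≤ d * r := by
    intro e
    have hsub : T e ⊆ (D e).biUnion fun b =>
        Finset.univ.filter fun i => ∃ a ∈ A i, G.Adj a b := by
      intro i hi
      obtain ⟨a, ha, b, hb, hab⟩ := (Finset.mem_filter.1 hi).2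
      exact Finset.mem_biUnion.2 ⟨b, hb, by simpa using ⟨a, ha, hab⟩⟩
    refine (Finset.card_le_card hsub).trans
      ((Finset.card_biUnion_le_card_mul _ _ r ?_).trans (Nat.mul_le_mul_right _ (hDd e)))
    intro b hb
    by_contra hcard
    obtain ⟨T', hT', hT'r⟩ := Finset.exists_subset_card_eq (not_le.1 hcard).le
    exact hT ⟨T', hT'r, (htouch (p e) T').2 ⟨b, hDB e hb, fun i hi =>
      (Finset.mem_filter.1 (hT' hi)).2⟩⟩
  let c : Fin n × Fin N → Fin f := fun z => X.orderEmbOfFin hXn (finProdFinEquiv z)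
  have hc : Function.Injective c :=
    (X.orderEmbOfFin hXn).injective.comp finProdFinEquiv.injective
  obtain ⟨φ, hφ⟩ := exists_free_transversal T hTcard c hc (by omega)
  let ψ : Fin n → Fin f := fun a => c (a, φ a)
  have hψ : Function.Injective ψ := fun a b h => congrArg Prod.fst (hc h)
  have hψX : ∀ a, ψ a ∈ X := fun a => X.orderEmbOfFin_mem hXn _
  have hψe : ∀ e : {e : Sym2 (Fin n) // ¬ e.IsDiag},
      (G.induce (D (e.1.map ψ) : Set V)).Connected ∧
        ∀ i ∈ e.1.map ψ, ∃ a ∈ A i, ∃ b ∈ D (e.1.map ψ), G.Adj a b := by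
    rintro ⟨e, he⟩
    refine hDe _ ?_ ?_
    · rwa [Sym2.isDiag_map hψ]
    · intro i hi
      obtain ⟨a, -, rfl⟩ := Sym2.mem_map.1 hi
      exact hψX a
  refine hasInducedMinor_completeSubdivision (fun a => A (ψ a))
    (fun e => (D (e.1.map ψ) : Set V)) (fun a => hA _) (fun e => (hψe e).1)
    (fun a b hab => hAA _ _ (hψ.ne hab)) ?_ ?_ ?_
  · intro e e' hne
    exact (hBB _ _ (y.injective.ne (p.injective.ne ((Sym2.map.injective hψ).ne
      (Subtype.val_injective.ne hne))))).mono (hDB _) (hDB _)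
  · intro a e
    exact (hAB _ _).1.mono_right (hDB _)
  · intro k e
    constructor
    · intro hk
      exact (hψe e).2 _ (Sym2.mem_map.2 ⟨k, hk, rfl⟩)
    · rintro ⟨a, ha, b, hb, hab⟩
      obtain ⟨e, he⟩ := e
      induction e with | _ u v
      by_contra hk
      rw [Sym2.mem_iff, not_or] at hk
      exact hφ u v k hk.1 hk.2 (Finset.mem_filter.2 ⟨Finset.mem_univ _, a, ha, b, hb, hab⟩)

lemma IsInducedModel.symm {V : Type} {G : SimpleGraph V} {s t : ℕ}
    {A : Fin s → Set V} {B : Fin t → Set V} (h : IsInducedModel G A B) :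
    IsInducedModel G B A := by
  obtain ⟨hA, hB, hAA, hBB, hAB⟩ := h
  exact ⟨hB, hA, hBB, hAA, fun j i => ⟨(hAB i j).1.symm, fun h' => (hAB i j).2 h'.symm⟩⟩

lemma IsInducedModel.comp {V : Type} {G : SimpleGraph V} {s t s' t' : ℕ}
    {A : Fin s → Set V} {B : Fin t → Set V} (h : IsInducedModel G A B)
    (x : Fin s' ↪ Fin s) (y : Fin t' ↪ Fin t) :
    IsInducedModel G (fun i => A (x i)) (fun j => B (y j)) := by
  obtain ⟨hA, hB, hAA, hBB, hAB⟩ := h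
  exact ⟨fun i => hA _, fun j => hB _, fun i j hij => hAA _ _ (x.injective.ne hij),
    fun i j hij => hBB _ _ (y.injective.ne hij), fun i j => hAB _ _⟩

/-- Lemma 7.4: for all positive `d, l, r, r', s` there are `f, g` such
that for every linear induced `(f,g)`-model `M = (A; B)` in a graph `G`, either there
is an `(r,r)`-constellation in `G`, or `G` has an induced minor isomorphic to a
1-subdivision of `K_{r'}`, or some sub-model `(A_i : i ∈ X; B_j : j ∈ Y)` with
`|X| = s`, `|Y| = l` is `d`-ample. -/
theorem stmt12 (d l r r' s : ℕ)
    (hd : 0 < d) (hl : 0 < l) (hr : 0 < r) (hr' : 0 < r') (hs : 0 < s) :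
    ∃ f g : ℕ, 0 < f ∧ 0 < g ∧
      ∀ (V : Type) [Fintype V] (G : SimpleGraph V)
        (A : Fin f → Set V) (B : Fin g → Set V),
        IsInducedModel G A B →
        (∀ i, IsPathSet G (A i)) → (∀ j, IsPathSet G (B j)) →
          (∃ W' S' : Set V, IsConstellationOn G W' S' ∧ S'.ncard = r ∧
              (CompsOn G (W' \ S')).ncard = r) ∨
          (∃ (m : ℕ) (H : SimpleGraph (Fin m)),
              IsSubdivisionWith H (⊤ : SimpleGraph (Fin r')) (fun n => n = 2) ∧
              HasInducedMinor G H) ∨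
          (∃ (x : Fin s ↪ Fin f) (y : Fin l ↪ Fin g),
              ModelAmple G (fun i => A (x i)) (fun j => B (y j)) d) := by
  obtain ⟨l₁, s₁, hl₁, -, H₁⟩ := exists_not_shortLink d s r r' l hs
  obtain ⟨f, g, hf, hg, H₂⟩ := exists_not_shortLink d l₁ r r' s₁ hl₁
  refine ⟨f, g, hf, hg, fun V _ G A B hM hpA hpB => ?_⟩
  rcases H₂ V G A B hM hpA with h | h | ⟨x, y, hxy⟩
  · exact Or.inl h
  · exact Or.inr (Or.inl (exists_subdivision_inducedMinor h))
  have hM' := hM.comp x y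
  rcases H₁ V G _ _ hM'.symm fun j => hpB _ with h | h | ⟨y', x', hyx⟩
  · exact Or.inl h
  · exact Or.inr (Or.inl (exists_subdivision_inducedMinor h))
  obtain ⟨-, -, hAA, hBB, -⟩ := hM'.comp x' y'
  exact Or.inr (Or.inr ⟨x'.trans x, y'.trans y,
    modelAAmple_of_not_shortLink hAA hBB fun i i' j hii => hxy _ _ _ (x'.injective.ne hii),
    modelAAmple_of_not_shortLink hBB hAA hyx⟩)
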